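/- Let H be a weak Hopf algebra over k, B a right H-comodule algebra, and h: H → B a total integral that is an algebra and comodule map. For any (H,B)-Doi-Hopf module M (a right B-module and right H-comodule with ρ_M(m·b) = m_[0]·b_(0) ⊗ m_[1]b_(1)), the map ω: M^{coH} ⊗_{B^{coH}} B → M, ω(n ⊗ b) = n·b, is an isomorphism of Doi-Hopf modules, with inverse induced by m ↦ q_M(m_[0]) ⊗ h(m_[1]), where q_M(m) = m_[0]·h(S(m_[1])) and M^{coH} = {m : ρ_M(m) = m_[0] ⊗ Π_L(m_[1])}. -/

import Mathlib

open TensorProduct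

noncomputable section

namespace DoiHopf

variable (k : Type) [Field k]
variable (H : Type) [Ring H] [Algebra k H]
variable (delta : H →ₗ[k] H ⊗[k] H) (eps : H →ₗ[k] k) (S : H →ₗ[k] H)

/-- regroup `(x ⊗ (y₁ ⊗ y₂)) ⊗ z ↦ (x ⊗ y₁) ⊗ (y₂ ⊗ z)`. -/
def regroup : (H ⊗[k] (H ⊗[k] H)) ⊗[k] H →ₗ[k] (H ⊗[k] H) ⊗[k] (H ⊗[k] H) :=
  (TensorProduct.assoc k (H ⊗[k] H) H H).toLinearMap
    ∘ₗ ((TensorProduct.assoc k H H H).symm.toLinearMap.rTensor H)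

/-- The target map `Π_L = μ ∘ (id ⊗ S) ∘ δ`. -/
def PiL : H →ₗ[k] H := LinearMap.mul' k H ∘ₗ S.lTensor H ∘ₗ delta

/-- The source map `Π_R = μ ∘ (S ⊗ id) ∘ δ`. -/
def PiR : H →ₗ[k] H := LinearMap.mul' k H ∘ₗ S.rTensor H ∘ₗ delta

/-- The formula `Π_L = (ε∘μ ⊗ id) ∘ (id ⊗ swap) ∘ (δ(1) ⊗ id)`, i.e.
`Π_L(x) = ε(1₍₁₎ x) 1₍₂₎`. -/
def PiLformula : H →ₗ[k] H :=
  (TensorProduct.lid k H).toLinearMap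
    ∘ₗ ((eps ∘ₗ LinearMap.mul' k H).rTensor H)
    ∘ₗ (TensorProduct.assoc k H H H).symm.toLinearMap
    ∘ₗ ((TensorProduct.comm k H H).toLinearMap.lTensor H)
    ∘ₗ (TensorProduct.assoc k H H H).toLinearMap
    ∘ₗ (TensorProduct.mk k (H ⊗[k] H) H (delta 1))

/-- The formula `Π_R = (id ⊗ ε∘μ) ∘ (swap ⊗ id) ∘ (id ⊗ δ(1))`, i.e.
`Π_R(x) = ε(x 1₍₂₎) 1₍₁₎`. -/
def PiRformula : H →ₗ[k] H :=
  (TensorProduct.rid k H).toLinearMap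
    ∘ₗ ((eps ∘ₗ LinearMap.mul' k H).lTensor H)
    ∘ₗ (TensorProduct.assoc k H H H).toLinearMap
    ∘ₗ ((TensorProduct.comm k H H).toLinearMap.rTensor H)
    ∘ₗ (TensorProduct.assoc k H H H).symm.toLinearMap
    ∘ₗ ((TensorProduct.mk k H (H ⊗[k] H)).flip (delta 1))

/-- A weak Hopf algebra structure on the associative unital algebra `H`, given by a
coassociative counital comultiplication `delta`, counit `eps` and antipode `S`
satisfying the multiplicativity of `delta`, the weak counit and weak unit axioms,
and the antipode axioms. -/
structure IsWeakHopfAlgebra : Prop where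
  coassoc : (TensorProduct.assoc k H H H).toLinearMap ∘ₗ delta.rTensor H ∘ₗ delta
      = delta.lTensor H ∘ₗ delta
  counit_left : ∀ x, (TensorProduct.lid k H) ((eps.rTensor H) (delta x)) = x
  counit_right : ∀ x, (TensorProduct.rid k H) ((eps.lTensor H) (delta x)) = x
  delta_mul : ∀ x y, delta (x * y) = delta x * delta y
  weak_counit₁ : eps ∘ₗ LinearMap.mul' k H ∘ₗ (LinearMap.mul' k H).rTensor H
      = (TensorProduct.lid k k).toLinearMap
        ∘ₗ (TensorProduct.map (eps ∘ₗ LinearMap.mul' k H) (eps ∘ₗ LinearMap.mul' k H))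
        ∘ₗ regroup k H ∘ₗ ((delta.lTensor H).rTensor H)
  weak_counit₂ : eps ∘ₗ LinearMap.mul' k H ∘ₗ (LinearMap.mul' k H).rTensor H
      = (TensorProduct.lid k k).toLinearMap
        ∘ₗ (TensorProduct.map (eps ∘ₗ LinearMap.mul' k H) (eps ∘ₗ LinearMap.mul' k H))
        ∘ₗ regroup k H
        ∘ₗ ((((TensorProduct.comm k H H).toLinearMap ∘ₗ delta).lTensor H).rTensor H)
  weak_unit₁ : delta.rTensor H (delta 1)
      = (delta 1 ⊗ₜ[k] (1 : H))
        * ((TensorProduct.assoc k H H H).symm ((1 : H) ⊗ₜ[k] delta 1))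
  weak_unit₂ : delta.rTensor H (delta 1)
      = ((TensorProduct.assoc k H H H).symm ((1 : H) ⊗ₜ[k] delta 1))
        * (delta 1 ⊗ₜ[k] (1 : H))
  piL_eq : PiL k H delta S = PiLformula k H delta eps
  piR_eq : PiR k H delta S = PiRformula k H delta eps
  S_mul_S : LinearMap.mul' k H ∘ₗ S.lTensor H
      ∘ₗ ((LinearMap.mul' k H ∘ₗ S.rTensor H).rTensor H)
      ∘ₗ delta.rTensor H ∘ₗ delta = S

/-- A right `H`-comodule algebra structure on the algebra `B`. -/
structure IsComoduleAlgebra {B : Type} [Ring B] [Algebra k B]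
    (rhoB : B →ₗ[k] B ⊗[k] H) : Prop where
  counit : ∀ b, (TensorProduct.rid k B) ((eps.lTensor B) (rhoB b)) = b
  coassoc : rhoB.rTensor H ∘ₗ rhoB
      = (TensorProduct.assoc k B H H).symm.toLinearMap ∘ₗ delta.lTensor B ∘ₗ rhoB
  mul_compat : ∀ a b, rhoB (a * b) = rhoB a * rhoB b
  weak_unit : rhoB.rTensor H (rhoB 1)
      = (rhoB 1 ⊗ₜ[k] (1 : H))
        * ((TensorProduct.assoc k B H H).symm ((1 : B) ⊗ₜ[k] delta 1))

variable (B : Type) [Ring B] [Algebra k B]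
variable (rhoB : B →ₗ[k] B ⊗[k] H) (h : H →ₗ[k] B)
variable (M : Type) [AddCommGroup M] [Module k M]
variable (phiM : M ⊗[k] B →ₗ[k] M) (rhoM : M →ₗ[k] M ⊗[k] H)

/-- The coinvariants `M^{coH} = {m : ρ_M(m) = m₍₀₎ ⊗ Π_L(m₍₁₎)}`. -/
def weakCoinv : Submodule k M :=
  LinearMap.eqLocus rhoM ((PiL k H delta S).lTensor M ∘ₗ rhoM)

/-- The canonical map `M^{coH} ⊗ B → M`, `n ⊗ b ↦ n · b`. -/
def omegaW : (weakCoinv k H delta S M rhoM) ⊗[k] B →ₗ[k] M :=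
  phiM ∘ₗ ((weakCoinv k H delta S M rhoM).subtype.rTensor B)

/-- The idempotent `q_M(m) = m₍₀₎ · h(S(m₍₁₎))`. -/
def qMW : M →ₗ[k] M := phiM ∘ₗ (h ∘ₗ S).lTensor M ∘ₗ rhoM

section Convolution

variable {k H delta eps S B rhoB h M phiM rhoM}
variable {N N' N'' A A' : Type} [AddCommGroup N] [Module k N] [AddCommGroup N'] [Module k N']
  [AddCommGroup N''] [Module k N''] [Ring A] [Algebra k A] [Ring A'] [Algebra k A']

/-- The action `m ↦ g(m₍₀₎) · f(m₍₁₎)` of `f : H → A` on `g : M → N`, where `M` is an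
`H`-comodule via `rho` and `A` acts on `N` via `phi`. -/
def convAct (rho : M →ₗ[k] M ⊗[k] H) (phi : N ⊗[k] A →ₗ[k] N')
    (g : M →ₗ[k] N) (f : H →ₗ[k] A) : M →ₗ[k] N' :=
  phi ∘ₗ TensorProduct.map g f ∘ₗ rho

/-- The convolution product `(f * g)(x) = f(x₍₁₎) g(x₍₂₎)`. -/
def conv (delta : H →ₗ[k] H ⊗[k] H) (f g : H →ₗ[k] A) : H →ₗ[k] A :=
  convAct delta (LinearMap.mul' k A) f g

theorem convAct_convAct {rho : M →ₗ[k] M ⊗[k] H} {phi : N ⊗[k] A →ₗ[k] N}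
    (coassoc : rho.rTensor H ∘ₗ rho
      = (TensorProduct.assoc k M H H).symm.toLinearMap ∘ₗ delta.lTensor M ∘ₗ rho)
    (assoc : ∀ (n : N) (a b : A), phi (phi (n ⊗ₜ[k] a) ⊗ₜ[k] b) = phi (n ⊗ₜ[k] (a * b)))
    (g : M →ₗ[k] N) (f₁ f₂ : H →ₗ[k] A) :
    convAct rho phi (convAct rho phi g f₁) f₂ = convAct rho phi g (conv delta f₁ f₂) := by
  ext m
  have h1 : ∀ t : M ⊗[k] H, phi (TensorProduct.map (convAct rho phi g f₁) f₂ t)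
      = phi (TensorProduct.map phi LinearMap.id
          (TensorProduct.map (TensorProduct.map g f₁) f₂ (rho.rTensor H t))) := by
    intro t
    induction t with
    | zero => simp
    | add x y hx hy => simp only [map_add, hx, hy]
    | tmul x y => simp [convAct]
  have h2 : ∀ (x : M) (s : H ⊗[k] H), phi (TensorProduct.map phi LinearMap.id
          (TensorProduct.map (TensorProduct.map g f₁) f₂
            ((TensorProduct.assoc k M H H).symm (x ⊗ₜ s))))
      = phi (g x ⊗ₜ LinearMap.mul' k A (TensorProduct.map f₁ f₂ s)) := by
    intro x s
    induction s with
    | zero => simp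
    | add x y hx hy => simp only [map_add, tmul_add, hx, hy]
    | tmul y z => simp [assoc]
  have h3 : ∀ t : M ⊗[k] H, phi (TensorProduct.map phi LinearMap.id
          (TensorProduct.map (TensorProduct.map g f₁) f₂
            ((TensorProduct.assoc k M H H).symm (delta.lTensor M t))))
      = phi (TensorProduct.map g (conv delta f₁ f₂) t) := by
    intro t
    induction t with
    | zero => simp
    | add x y hx hy => simp only [map_add, hx, hy]
    | tmul x y => simp [h2, conv, convAct]
  have h4 := LinearMap.congr_fun coassoc m
  simp only [LinearMap.comp_apply, LinearEquiv.coe_coe] at h4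
  change phi (TensorProduct.map (convAct rho phi g f₁) f₂ (rho m)) = phi _
  rw [h1, h4, h3]
  rfl

theorem conv_assoc (coassoc : (TensorProduct.assoc k H H H).toLinearMap ∘ₗ delta.rTensor H ∘ₗ delta
      = delta.lTensor H ∘ₗ delta) (f₁ f₂ f₃ : H →ₗ[k] A) :
    conv delta (conv delta f₁ f₂) f₃ = conv delta f₁ (conv delta f₂ f₃) := by
  refine convAct_convAct ?_ (fun n a b => by simp [mul_assoc]) f₁ f₂ f₃
  rw [← coassoc]
  ext x
  simp

theorem comp_convAct {rho : M →ₗ[k] M ⊗[k] H} {phi : N ⊗[k] A →ₗ[k] N}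
    {phi' : N' ⊗[k] A' →ₗ[k] N''} {T : N →ₗ[k] N''} {U : N →ₗ[k] N'} {τ : A →ₗ[k] A'}
    (hT : ∀ n a, T (phi (n ⊗ₜ a)) = phi' (U n ⊗ₜ τ a)) (g : M →ₗ[k] N) (f : H →ₗ[k] A) :
    T ∘ₗ convAct rho phi g f = convAct rho phi' (U ∘ₗ g) (τ ∘ₗ f) := by
  have : T ∘ₗ phi = phi' ∘ₗ TensorProduct.map U τ := by
    ext n a
    simp [hT]
  rw [convAct, convAct, TensorProduct.map_comp, ← LinearMap.comp_assoc, this]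
  rfl

/-- An algebra map is compatible with convolution. -/
theorem comp_conv {τ : A →ₗ[k] A'} (hτ : ∀ a b, τ (a * b) = τ a * τ b) (f g : H →ₗ[k] A) :
    τ ∘ₗ conv delta f g = conv delta (τ ∘ₗ f) (τ ∘ₗ g) :=
  comp_convAct (fun a b => by simp [hτ]) f g

end Convolution

section WeakHopf

variable {k H delta eps S}

theorem PiL_eq_conv : PiL k H delta S = conv delta LinearMap.id S := rfl

theorem PiR_eq_conv : PiR k H delta S = conv delta S LinearMap.id := rfl

theorem PiLformula_apply (x : H) : PiLformula k H delta eps x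
    = TensorProduct.lid k H ((eps ∘ₗ LinearMap.mulRight k x).rTensor H (delta 1)) := by
  simp only [PiLformula, LinearMap.comp_apply, TensorProduct.mk_apply]
  induction delta 1 with
  | zero => simp
  | add a b ha hb => simp only [map_add, add_tmul, ha, hb]
  | tmul a b => simp

theorem PiRformula_apply (x : H) : PiRformula k H delta eps x
    = TensorProduct.rid k H ((eps ∘ₗ LinearMap.mulLeft k x).lTensor H (delta 1)) := by
  simp only [PiRformula, LinearMap.comp_apply, LinearMap.flip_apply, TensorProduct.mk_apply]
  induction delta 1 with
  | zero => simp
  | add a b ha hb => simp only [map_add, tmul_add, ha, hb]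
  | tmul a b => simp

theorem assoc_symm_mul (a : H) (s t : H ⊗[k] H) :
    (TensorProduct.assoc k H H H).symm ((1 : H) ⊗ₜ s)
      * (TensorProduct.assoc k H H H).symm (a ⊗ₜ t)
      = (TensorProduct.assoc k H H H).symm (a ⊗ₜ (s * t)) := by
  induction s with
  | zero => simp
  | add u v hu hv => simp only [map_add, tmul_add, add_mul, hu, hv]
  | tmul u v =>
    induction t with
    | zero => simp
    | add c d hc hd => simp only [map_add, tmul_add, mul_add, hc, hd]
    | tmul c d => simp

namespace IsWeakHopfAlgebra

theorem assoc_symm_delta (hH : IsWeakHopfAlgebra k H delta eps S) (x : H) :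
    delta.rTensor H (delta x)
      = (TensorProduct.assoc k H H H).symm (delta.lTensor H (delta x)) := by
  rw [LinearEquiv.eq_symm_apply]
  exact LinearMap.congr_fun hH.coassoc x

theorem PiL_apply (hH : IsWeakHopfAlgebra k H delta eps S) (x : H) : PiL k H delta S x
    = TensorProduct.lid k H ((eps ∘ₗ LinearMap.mulRight k x).rTensor H (delta 1)) := by
  rw [hH.piL_eq, PiLformula_apply]

theorem PiR_apply (hH : IsWeakHopfAlgebra k H delta eps S) (x : H) : PiR k H delta S x
    = TensorProduct.rid k H ((eps ∘ₗ LinearMap.mulLeft k x).lTensor H (delta 1)) := by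
  rw [hH.piR_eq, PiRformula_apply]

/-- `x₍₁₎ ⊗ Π_L(x₍₂₎) = 1₍₁₎ x ⊗ 1₍₂₎`. -/
theorem lTensor_PiL_delta (hH : IsWeakHopfAlgebra k H delta eps S) (x : H) :
    (PiL k H delta S).lTensor H (delta x) = delta 1 * (x ⊗ₜ 1) := by
  let Φ : (H ⊗[k] H) ⊗[k] H →ₗ[k] H ⊗[k] H :=
    ((TensorProduct.rid k H).toLinearMap ∘ₗ eps.lTensor H).rTensor H
  have h1 : ∀ t : H ⊗[k] H, Φ (delta.rTensor H t * (delta x ⊗ₜ 1)) = t * (x ⊗ₜ 1) := by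
    intro t
    induction t with
    | zero => simp
    | add a b ha hb => simp only [map_add, add_mul, ha, hb]
    | tmul a b => simp [Φ, ← hH.delta_mul, hH.counit_right]
  have h2 : ∀ s : H ⊗[k] H,
      Φ ((TensorProduct.assoc k H H H).symm ((1 : H) ⊗ₜ[k] delta 1) * (s ⊗ₜ 1))
        = (PiL k H delta S).lTensor H s := by
    intro s
    induction s with
    | zero => simp
    | add a b ha hb => simp only [map_add, add_tmul, mul_add, ha, hb]
    | tmul a b =>
      rw [LinearMap.lTensor_tmul, hH.PiL_apply]
      induction delta 1 with
      | zero => simp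
      | add c d hc hd => simp only [map_add, tmul_add, add_mul, hc, hd]
      | tmul c d => simp [Φ, TensorProduct.smul_tmul]
  rw [← h1 (delta 1), hH.weak_unit₂, mul_assoc, Algebra.TensorProduct.tmul_mul_tmul,
    ← hH.delta_mul, one_mul, one_mul, h2]

/-- `Π_R(x₍₁₎) ⊗ x₍₂₎ = 1₍₁₎ ⊗ x 1₍₂₎`. -/
theorem rTensor_PiR_delta (hH : IsWeakHopfAlgebra k H delta eps S) (x : H) :
    (PiR k H delta S).rTensor H (delta x) = (1 ⊗ₜ x) * delta 1 := by
  let Φ : (H ⊗[k] H) ⊗[k] H →ₗ[k] H ⊗[k] H :=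
    ((TensorProduct.rid k H).toLinearMap ∘ₗ eps.lTensor H).rTensor H
  have h0 : ∀ (c : H) (s : H ⊗[k] H), Φ ((TensorProduct.assoc k H H H).symm (c ⊗ₜ s))
      = c ⊗ₜ TensorProduct.lid k H (eps.rTensor H s) := by
    intro c s
    induction s with
    | zero => simp
    | add a b ha hb => simp only [map_add, tmul_add, ha, hb]
    | tmul a b => simp [Φ, TensorProduct.smul_tmul]
  have h1 : ∀ t : H ⊗[k] H, Φ ((TensorProduct.assoc k H H H).symm ((1 : H) ⊗ₜ delta x)
      * (TensorProduct.assoc k H H H).symm (delta.lTensor H t)) = (1 ⊗ₜ x) * t := by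
    intro t
    induction t with
    | zero => simp
    | add a b ha hb => simp only [map_add, mul_add, ha, hb]
    | tmul a b =>
      rw [LinearMap.lTensor_tmul, assoc_symm_mul, ← hH.delta_mul, h0, hH.counit_left]
      simp
  have h2 : ∀ s : H ⊗[k] H,
      Φ ((TensorProduct.assoc k H H H).symm ((1 : H) ⊗ₜ[k] s) * (delta 1 ⊗ₜ 1))
        = (PiR k H delta S).rTensor H s := by
    intro s
    induction s with
    | zero => simp
    | add a b ha hb => simp only [map_add, tmul_add, add_mul, ha, hb]
    | tmul a b =>
      rw [LinearMap.rTensor_tmul, hH.PiR_apply]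
      induction delta 1 with
      | zero => simp
      | add c d hc hd => simp only [map_add, add_tmul, mul_add, hc, hd]
      | tmul c d => simp [Φ]
  rw [← h1 (delta 1), ← hH.assoc_symm_delta, hH.weak_unit₂, ← mul_assoc, assoc_symm_mul,
    ← hH.delta_mul, mul_one, h2]

/-- `δ(Π_L(x)) = 1₍₁₎ Π_L(x) ⊗ 1₍₂₎ = Π_L(x) 1₍₁₎ ⊗ 1₍₂₎`. -/
theorem delta_PiL (hH : IsWeakHopfAlgebra k H delta eps S) (x : H) :
    delta (PiL k H delta S x) = delta 1 * (PiL k H delta S x ⊗ₜ 1)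
      ∧ delta (PiL k H delta S x) = (PiL k H delta S x ⊗ₜ 1) * delta 1 := by
  let P : H ⊗[k] H →ₗ[k] H :=
    (TensorProduct.lid k H).toLinearMap ∘ₗ (eps ∘ₗ LinearMap.mulRight k x).rTensor H
  have hP : PiL k H delta S x = P (delta 1) := hH.PiL_apply x
  have h0 : ∀ (c : H) (s : H ⊗[k] H),
      P.rTensor H ((TensorProduct.assoc k H H H).symm (c ⊗ₜ s)) = eps (c * x) • s := by
    intro c s
    induction s with
    | zero => simp
    | add a b ha hb => simp only [map_add, tmul_add, smul_add, ha, hb]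
    | tmul a b => simp [P, TensorProduct.smul_tmul']
  have h1 : ∀ t : H ⊗[k] H, delta (P t)
      = P.rTensor H ((TensorProduct.assoc k H H H).symm (delta.lTensor H t)) := by
    intro t
    induction t with
    | zero => simp
    | add a b ha hb => simp only [map_add, ha, hb]
    | tmul a b => simp [h0, P]
  have h2 : ∀ s t : H ⊗[k] H,
      P.rTensor H ((TensorProduct.assoc k H H H).symm ((1 : H) ⊗ₜ[k] t) * (s ⊗ₜ 1))
        = t * (P s ⊗ₜ 1)
      ∧ P.rTensor H ((s ⊗ₜ 1) * (TensorProduct.assoc k H H H).symm ((1 : H) ⊗ₜ[k] t))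
        = (P s ⊗ₜ 1) * t := by
    intro s t
    induction s with
    | zero => simp
    | add a b ha hb =>
      simp only [map_add, add_tmul, mul_add, add_mul, ha.1, hb.1, ha.2, hb.2, and_self]
    | tmul a b =>
      induction t with
      | zero => simp
      | add c d hc hd =>
        simp only [map_add, tmul_add, mul_add, add_mul, hc.1, hd.1, hc.2, hd.2, and_self]
      | tmul c d => simp [P]
  rw [hP, h1, ← hH.assoc_symm_delta, ← (h2 _ _).1, ← (h2 _ _).2, ← hH.weak_unit₁,
    ← hH.weak_unit₂]
  exact ⟨rfl, rfl⟩

/-- `δ(Π_R(x)) = 1₍₁₎ ⊗ Π_R(x) 1₍₂₎`. -/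
theorem delta_PiR (hH : IsWeakHopfAlgebra k H delta eps S) (x : H) :
    delta (PiR k H delta S x) = (1 ⊗ₜ PiR k H delta S x) * delta 1 := by
  let P : H ⊗[k] H →ₗ[k] H :=
    (TensorProduct.rid k H).toLinearMap ∘ₗ (eps ∘ₗ LinearMap.mulLeft k x).lTensor H
  let Q : (H ⊗[k] H) ⊗[k] H →ₗ[k] H ⊗[k] H :=
    (TensorProduct.rid k (H ⊗[k] H)).toLinearMap
      ∘ₗ (eps ∘ₗ LinearMap.mulLeft k x).lTensor (H ⊗[k] H)
  have hP : PiR k H delta S x = P (delta 1) := hH.PiR_apply x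
  have h1 : ∀ t : H ⊗[k] H, delta (P t) = Q (delta.rTensor H t) := by
    intro t
    induction t with
    | zero => simp
    | add a b ha hb => simp only [map_add, ha, hb]
    | tmul a b => simp [Q, P]
  have h2 : ∀ s t : H ⊗[k] H,
      Q ((TensorProduct.assoc k H H H).symm ((1 : H) ⊗ₜ[k] t) * (s ⊗ₜ 1))
        = (1 ⊗ₜ P t) * s := by
    intro s t
    induction s with
    | zero => simp
    | add a b ha hb => simp only [add_tmul, mul_add, map_add, ha, hb]
    | tmul a b =>
      induction t with
      | zero => simp
      | add c d hc hd => simp only [map_add, tmul_add, add_mul, hc, hd]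
      | tmul c d => simp [P, Q]
  rw [hP, h1, hH.weak_unit₂, h2]

theorem PiL_PiL (hH : IsWeakHopfAlgebra k H delta eps S) (x : H) :
    PiL k H delta S (PiL k H delta S x) = PiL k H delta S x := by
  conv_rhs => rw [← hH.counit_left (PiL k H delta S x), (hH.delta_PiL x).1]
  rw [hH.PiL_apply (PiL k H delta S x)]
  induction delta 1 with
  | zero => simp
  | add a b ha hb => simp only [map_add, add_mul, ha, hb]
  | tmul a b => simp

/-- `Π_R(x₍₁₎) ⊗ Π_L(x₍₂₎) = Π_R(x₍₂₎) ⊗ Π_L(x₍₁₎)`. -/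
theorem conv_PiR_PiL_comm (hH : IsWeakHopfAlgebra k H delta eps S) :
    conv delta (TensorProduct.mk k H H 1 ∘ₗ PiL k H delta S)
        ((TensorProduct.mk k H H).flip 1 ∘ₗ PiR k H delta S)
      = conv delta ((TensorProduct.mk k H H).flip 1 ∘ₗ PiR k H delta S)
        (TensorProduct.mk k H H 1 ∘ₗ PiL k H delta S) := by
  ext x
  have hl := fun u v => LinearMap.congr_fun hH.weak_counit₁ ((u ⊗ₜ x) ⊗ₜ v)
  have hr := fun u v => LinearMap.congr_fun hH.weak_counit₂ ((u ⊗ₜ x) ⊗ₜ v)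
  have hlr := fun u v => (hl u v).symm.trans (hr u v)
  simp only [LinearMap.comp_apply, LinearMap.rTensor_tmul, LinearMap.lTensor_tmul,
    LinearEquiv.coe_coe] at hlr
  obtain ⟨s, hs⟩ := TensorProduct.exists_finset (delta 1)
  have hPL : ∀ y, PiL k H delta S y = ∑ i ∈ s, eps (i.1 * y) • i.2 := by
    intro y
    simp [hH.PiL_apply, hs]
  have hPR : ∀ y, PiR k H delta S y = ∑ j ∈ s, eps (y * j.2) • j.1 := by
    intro y
    simp [hH.PiR_apply, hs]
  let θ : H → H → H ⊗[k] H → k := fun u v d =>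
    TensorProduct.lid k k (TensorProduct.map (eps ∘ₗ LinearMap.mul' k H)
      (eps ∘ₗ LinearMap.mul' k H) (regroup k H ((u ⊗ₜ d) ⊗ₜ v)))
  have hθ_zero : ∀ u v, θ u v 0 = 0 := by simp [θ]
  have hθ_add : ∀ u v d e, θ u v (d + e) = θ u v d + θ u v e := by
    simp [θ, add_tmul, tmul_add]
  have hθ_tmul : ∀ u v a b, θ u v (a ⊗ₜ b) = eps (u * a) * eps (b * v) := by
    simp [θ, regroup]
  have hL : ∀ d, LinearMap.mul' k (H ⊗[k] H) (TensorProduct.map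
      (TensorProduct.mk k H H 1 ∘ₗ PiL k H delta S)
      ((TensorProduct.mk k H H).flip 1 ∘ₗ PiR k H delta S) d)
      = ∑ i ∈ s, ∑ j ∈ s, θ i.1 j.2 d • (j.1 ⊗ₜ[k] i.2) := by
    intro d
    induction d with
    | zero => simp [hθ_zero]
    | add a b ha hb => simp only [map_add, ha, hb, hθ_add, add_smul, Finset.sum_add_distrib]
    | tmul a b =>
      simp only [TensorProduct.map_tmul, LinearMap.comp_apply, LinearMap.mul'_apply, hPL, hPR,
        map_sum, map_smul, Finset.sum_mul_sum]
      simp [hθ_tmul, smul_smul, mul_comm (eps (_ * a))]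
  have hR : ∀ d, LinearMap.mul' k (H ⊗[k] H) (TensorProduct.map
      ((TensorProduct.mk k H H).flip 1 ∘ₗ PiR k H delta S)
      (TensorProduct.mk k H H 1 ∘ₗ PiL k H delta S) d)
      = ∑ i ∈ s, ∑ j ∈ s, θ i.1 j.2 (TensorProduct.comm k H H d) • (j.1 ⊗ₜ[k] i.2) := by
    intro d
    induction d with
    | zero => simp [hθ_zero]
    | add a b ha hb => simp only [map_add, ha, hb, hθ_add, add_smul, Finset.sum_add_distrib]
    | tmul a b =>
      rw [Finset.sum_comm]
      simp only [TensorProduct.map_tmul, LinearMap.comp_apply, LinearMap.mul'_apply, hPL, hPR,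
        map_sum, map_smul, Finset.sum_mul_sum]
      simp [hθ_tmul, smul_smul, mul_comm]
  change LinearMap.mul' k (H ⊗[k] H) (TensorProduct.map _ _ (delta x))
    = LinearMap.mul' k (H ⊗[k] H) (TensorProduct.map _ _ (delta x))
  rw [hL, hR]
  exact Finset.sum_congr rfl fun i _ => Finset.sum_congr rfl fun j _ => by
    rw [show θ i.1 j.2 (delta x) = _ from hlr i.1 j.2]

/-- The antipode is anti-comultiplicative: `δ(S(x)) = S(x₍₂₎) ⊗ S(x₍₁₎)`. -/
theorem delta_comp_S (hH : IsWeakHopfAlgebra k H delta eps S) :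
    delta ∘ₗ S = conv delta (TensorProduct.mk k H H 1 ∘ₗ S)
      ((TensorProduct.mk k H H).flip 1 ∘ₗ S) := by
  -- `G` and `δ ∘ S` are both generalized convolution inverses of `δ`
  let a : H →ₗ[k] H ⊗[k] H := (TensorProduct.mk k H H).flip 1
  let b : H →ₗ[k] H ⊗[k] H := TensorProduct.mk k H H 1
  have ha : ∀ x y, a (x * y) = a x * a y := by simp [a]
  have hb : ∀ x y, b (x * y) = b x * b y := by simp [b]
  have assoc := fun f₁ f₂ f₃ => conv_assoc (A := H ⊗[k] H) hH.coassoc f₁ f₂ f₃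
  let F := delta ∘ₗ S
  let G := conv delta (b ∘ₗ S) (a ∘ₗ S)
  have haL : conv delta a (a ∘ₗ S) = a ∘ₗ PiL k H delta S := by
    rw [PiL_eq_conv, comp_conv ha, LinearMap.comp_id]
  have hbL : conv delta b (b ∘ₗ S) = b ∘ₗ PiL k H delta S := by
    rw [PiL_eq_conv, comp_conv hb, LinearMap.comp_id]
  have haR : conv delta (a ∘ₗ S) a = a ∘ₗ PiR k H delta S := by
    rw [PiR_eq_conv, comp_conv ha, LinearMap.comp_id]
  have hbR : conv delta (b ∘ₗ S) b = b ∘ₗ PiR k H delta S := by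
    rw [PiR_eq_conv, comp_conv hb, LinearMap.comp_id]
  have hSS : conv delta (conv delta S LinearMap.id) S = S := by
    have : ∀ t : H ⊗[k] H, LinearMap.mul' k H (S.lTensor H
        ((LinearMap.mul' k H ∘ₗ S.rTensor H).rTensor H (delta.rTensor H t)))
        = LinearMap.mul' k H (TensorProduct.map (PiR k H delta S) S t) := by
      intro t
      induction t with
      | zero => simp
      | add a b ha hb => simp only [map_add, ha, hb]
      | tmul a b => simp [PiR]
    ext x
    exact (this (delta x)).symm.trans (LinearMap.congr_fun hH.S_mul_S x)
  have hSS' : conv delta S (conv delta LinearMap.id S) = S := by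
    rw [← conv_assoc hH.coassoc, hSS]
  have hab : conv delta a b = delta := by
    ext x
    change LinearMap.mul' k (H ⊗[k] H) (TensorProduct.map a b (delta x)) = _
    induction delta x with
    | zero => simp
    | add a b ha hb => simp only [map_add, ha, hb]
    | tmul x y => simp [a, b]
  have h1 : conv delta delta G = delta ∘ₗ PiL k H delta S := by
    have hA : conv delta a (b ∘ₗ PiL k H delta S) = LinearMap.mulLeft k (delta 1) ∘ₗ a := by
      ext x
      refine Eq.trans ?_ (hH.lTensor_PiL_delta x)
      change LinearMap.mul' k (H ⊗[k] H) (TensorProduct.map _ _ (delta x)) = _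
      induction delta x with
      | zero => simp
      | add a b ha hb => simp only [map_add, ha, hb]
      | tmul x y => simp [a, b]
    have e : conv delta delta G = conv delta (conv delta a b) G :=
      congrArg (conv delta · G) hab.symm
    rw [e, assoc, ← assoc b, hbL, ← assoc, hA]
    have := comp_convAct (rho := delta) (phi := LinearMap.mul' k (H ⊗[k] H))
      (phi' := LinearMap.mul' k (H ⊗[k] H)) (T := LinearMap.mulLeft k (delta 1))
      (U := LinearMap.mulLeft k (delta 1)) (τ := LinearMap.id)
      (fun n a => by simp [mul_assoc]) a (a ∘ₗ S)
    refine this.symm.trans ?_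
    change LinearMap.mulLeft k (delta 1) ∘ₗ conv delta a (a ∘ₗ S) = _
    rw [haL]
    ext x
    exact (hH.delta_PiL x).1.symm
  have h2 : conv delta G delta = delta ∘ₗ PiR k H delta S := by
    have hA : conv delta (a ∘ₗ PiR k H delta S) b = LinearMap.mulRight k (delta 1) ∘ₗ b := by
      ext x
      refine Eq.trans ?_ (hH.rTensor_PiR_delta x)
      change LinearMap.mul' k (H ⊗[k] H) (TensorProduct.map _ _ (delta x)) = _
      induction delta x with
      | zero => simp
      | add a b ha hb => simp only [map_add, ha, hb]
      | tmul x y => simp [a, b]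
    have e : conv delta G delta = conv delta G (conv delta a b) :=
      congrArg (conv delta G) hab.symm
    rw [e, assoc, ← assoc _ a, haR, hA]
    have := comp_convAct (rho := delta) (phi := LinearMap.mul' k (H ⊗[k] H))
      (phi' := LinearMap.mul' k (H ⊗[k] H)) (T := LinearMap.mulRight k (delta 1))
      (U := LinearMap.id) (τ := LinearMap.mulRight k (delta 1))
      (fun n a => by simp [mul_assoc]) (b ∘ₗ S) b
    refine this.symm.trans ?_
    change LinearMap.mulRight k (delta 1) ∘ₗ conv delta (b ∘ₗ S) b = _
    rw [hbR]
    ext x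
    exact (hH.delta_PiR x).symm
  have h3 : conv delta G (conv delta delta G) = G := by
    have e : conv delta delta G
        = conv delta a (conv delta (b ∘ₗ PiL k H delta S) (a ∘ₗ S)) := by
      refine (congrArg (conv delta · G) hab.symm).trans ?_
      rw [assoc, ← assoc b, hbL]
    rw [e, assoc, ← assoc _ a, haR, ← assoc (a ∘ₗ PiR k H delta S),
      ← hH.conv_PiR_PiL_comm, assoc, ← assoc (b ∘ₗ S)]
    have e1 : conv delta (b ∘ₗ S) (b ∘ₗ PiL k H delta S) = b ∘ₗ S := by
      rw [PiL_eq_conv, ← comp_conv hb, hSS']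
    have e2 : conv delta (a ∘ₗ PiR k H delta S) (a ∘ₗ S) = a ∘ₗ S := by
      rw [PiR_eq_conv, ← comp_conv ha, hSS]
    rw [e1, e2]
  have h4 : conv delta delta F = delta ∘ₗ PiL k H delta S :=
    (comp_conv hH.delta_mul LinearMap.id S).symm
  have h5 : conv delta F delta = delta ∘ₗ PiR k H delta S :=
    (comp_conv hH.delta_mul S LinearMap.id).symm
  have h6 : conv delta F (conv delta delta F) = F := by
    rw [h4, PiL_eq_conv, ← comp_conv hH.delta_mul, hSS']
  calc F = conv delta F (conv delta delta G) := by rw [h1, ← h4, h6]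
    _ = conv delta G (conv delta delta G) := by rw [← assoc, h5, ← h2, assoc]
    _ = G := h3

end IsWeakHopfAlgebra

end WeakHopf

section DoiHopfModule

variable {k H delta eps S B rhoB h M phiM rhoM}

/-- The diagonal action `(m ⊗ x) · (b ⊗ y) = m·b ⊗ xy` of `B ⊗ H` on `M ⊗ H`. -/
def diagAct (phiM : M ⊗[k] B →ₗ[k] M) : (M ⊗[k] H) ⊗[k] (B ⊗[k] H) →ₗ[k] M ⊗[k] H :=
  TensorProduct.map phiM (LinearMap.mul' k H)
    ∘ₗ (TensorProduct.tensorTensorTensorComm k M H B H).toLinearMap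

@[simp]
theorem diagAct_tmul (m : M) (x : H) (b : B) (y : H) :
    diagAct phiM ((m ⊗ₜ[k] x) ⊗ₜ (b ⊗ₜ y)) = phiM (m ⊗ₜ b) ⊗ₜ (x * y) := by
  simp [diagAct]

variable (k H delta eps B rhoB M phiM rhoM) in
/-- An `(H, B)`-Doi-Hopf module structure on `M`. -/
structure IsDoiHopfModule : Prop where
  counit : ∀ m, (TensorProduct.rid k M) ((eps.lTensor M) (rhoM m)) = m
  coassoc : rhoM.rTensor H ∘ₗ rhoM
    = (TensorProduct.assoc k M H H).symm.toLinearMap ∘ₗ delta.lTensor M ∘ₗ rhoM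
  act_one : ∀ m, phiM (m ⊗ₜ[k] (1 : B)) = m
  act_assoc : ∀ (m : M) (a b : B),
    phiM (phiM (m ⊗ₜ[k] a) ⊗ₜ[k] b) = phiM (m ⊗ₜ[k] (a * b))
  compat : ∀ m b, rhoM (phiM (m ⊗ₜ b)) = diagAct phiM (rhoM m ⊗ₜ rhoB b)

/-- A comodule algebra is a Doi-Hopf module over itself. -/
theorem IsComoduleAlgebra.isDoiHopfModule (hB : IsComoduleAlgebra k H delta eps rhoB) :
    IsDoiHopfModule k H delta eps B rhoB B (LinearMap.mul' k B) rhoB where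
  counit := hB.counit
  coassoc := hB.coassoc
  act_one := by simp
  act_assoc := by simp [mul_assoc]
  compat a b := by
    rw [LinearMap.mul'_apply, hB.mul_compat]
    induction rhoB a with
    | zero => simp
    | add u v hu hv => simp only [map_add, add_tmul, add_mul, hu, hv]
    | tmul u v =>
      induction rhoB b with
      | zero => simp
      | add c d hc hd => simp only [map_add, tmul_add, mul_add, hc, hd]
      | tmul c d => simp

namespace IsDoiHopfModule

theorem diagAct_diagAct (hM : IsDoiHopfModule k H delta eps B rhoB M phiM rhoM)
    (s : M ⊗[k] H) (u v : B ⊗[k] H) :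
    diagAct phiM (diagAct phiM (s ⊗ₜ u) ⊗ₜ v) = diagAct phiM (s ⊗ₜ (u * v)) := by
  induction s with
  | zero => simp
  | add a b ha hb => simp only [map_add, add_tmul, ha, hb]
  | tmul m x =>
    induction u with
    | zero => simp
    | add a b ha hb => simp only [map_add, add_tmul, tmul_add, add_mul, ha, hb]
    | tmul b y =>
      induction v with
      | zero => simp
      | add a b ha hb => simp only [map_add, tmul_add, mul_add, ha, hb]
      | tmul c z => simp [hM.act_assoc, mul_assoc]

theorem diagAct_rTensor (hM : IsDoiHopfModule k H delta eps B rhoB M phiM rhoM)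
    (n : M) (u v : B ⊗[k] H) :
    diagAct phiM ((phiM ∘ₗ TensorProduct.mk k M B n).rTensor H u ⊗ₜ v)
      = (phiM ∘ₗ TensorProduct.mk k M B n).rTensor H (u * v) := by
  induction u with
  | zero => simp
  | add a b ha hb => simp only [map_add, add_tmul, add_mul, ha, hb]
  | tmul b y =>
    induction v with
    | zero => simp
    | add a b ha hb => simp only [map_add, tmul_add, mul_add, ha, hb]
    | tmul c z => simp [hM.act_assoc]

/-- `m·1₍₀₎ ⊗ 1₍₁₎ = m₍₀₎ ⊗ ε(m₍₁₎ 1₍₁₎) 1₍₂₎`. -/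
theorem rTensor_rhoB_one (hM : IsDoiHopfModule k H delta eps B rhoB M phiM rhoM)
    (hB : IsComoduleAlgebra k H delta eps rhoB) (m : M) :
    (phiM ∘ₗ TensorProduct.mk k M B m).rTensor H (rhoB 1)
      = ((TensorProduct.lid k H).toLinearMap ∘ₗ eps.rTensor H ∘ₗ LinearMap.mulRight k (delta 1)
          ∘ₗ (TensorProduct.mk k H H).flip 1).lTensor M (rhoM m) := by
  set θ : H →ₗ[k] H := (TensorProduct.lid k H).toLinearMap ∘ₗ eps.rTensor H
    ∘ₗ LinearMap.mulRight k (delta 1) ∘ₗ (TensorProduct.mk k H H).flip 1 with hθ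
  let C : (M ⊗[k] H) ⊗[k] H →ₗ[k] M ⊗[k] H :=
    ((TensorProduct.rid k M).toLinearMap ∘ₗ eps.lTensor M).rTensor H
  let D : (M ⊗[k] H) ⊗[k] ((B ⊗[k] H) ⊗[k] H) →ₗ[k] (M ⊗[k] H) ⊗[k] H :=
    (diagAct phiM).rTensor H ∘ₗ (TensorProduct.assoc k (M ⊗[k] H) (B ⊗[k] H) H).symm.toLinearMap
  have h1 : ∀ (s : M ⊗[k] H) (u : B ⊗[k] H),
      C (D (s ⊗ₜ ((u ⊗ₜ[k] (1 : H)) * (TensorProduct.assoc k B H H).symm ((1 : B) ⊗ₜ delta 1))))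
        = θ.lTensor M (diagAct phiM (s ⊗ₜ u)) := by
    intro s u
    induction s with
    | zero => simp
    | add a b ha hb => simp only [map_add, add_tmul, ha, hb]
    | tmul m x =>
      induction u with
      | zero => simp
      | add a b ha hb => simp only [map_add, add_tmul, tmul_add, add_mul, ha, hb]
      | tmul b y =>
        rw [diagAct_tmul, LinearMap.lTensor_tmul, hθ]
        simp only [LinearMap.comp_apply, LinearMap.mulRight_apply]
        induction delta 1 with
        | zero => simp
        | add c d hc hd => simp only [map_add, tmul_add, mul_add, hc, hd]
        | tmul c d => simp [C, D, TensorProduct.smul_tmul, mul_assoc]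
  have h2 : ∀ u : B ⊗[k] H, C (D (rhoM m ⊗ₜ rhoB.rTensor H u))
      = (phiM ∘ₗ TensorProduct.mk k M B m).rTensor H u := by
    intro u
    induction u with
    | zero => simp
    | add a b ha hb => simp only [map_add, tmul_add, ha, hb]
    | tmul b y => simp [C, D, ← hM.compat, hM.counit]
  rw [← h2, hB.weak_unit, h1, ← hM.compat, hM.act_one]

/-- `ρ(n·b) = n·b₍₀₎ ⊗ b₍₁₎` for `n` coinvariant. -/
theorem rhoM_act_of_mem_weakCoinv (hM : IsDoiHopfModule k H delta eps B rhoB M phiM rhoM)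
    (hH : IsWeakHopfAlgebra k H delta eps S) (hB : IsComoduleAlgebra k H delta eps rhoB)
    {n : M} (hn : n ∈ weakCoinv k H delta S M rhoM) (b : B) :
    rhoM (phiM (n ⊗ₜ b)) = (phiM ∘ₗ TensorProduct.mk k M B n).rTensor H (rhoB b) := by
  have hn' : rhoM n = (PiL k H delta S).lTensor M (rhoM n) := hn
  have key : rhoM n = (phiM ∘ₗ TensorProduct.mk k M B n).rTensor H (rhoB 1) := by
    rw [hM.rTensor_rhoB_one hB]
    conv_rhs => rw [hn', ← LinearMap.comp_apply, ← LinearMap.lTensor_comp]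
    conv_lhs => rw [hn']
    congr 2
    ext x
    simp only [LinearMap.comp_apply, LinearMap.flip_apply, TensorProduct.mk_apply,
      LinearMap.mulRight_apply, ← (hH.delta_PiL x).2]
    exact (hH.counit_left _).symm
  rw [hM.compat, key, hM.diagAct_rTensor, ← hB.mul_compat, one_mul]

/-- `M^{coH}` is stable under the action of `B^{coH}`. -/
theorem act_mem_weakCoinv (hM : IsDoiHopfModule k H delta eps B rhoB M phiM rhoM)
    (hH : IsWeakHopfAlgebra k H delta eps S) (hB : IsComoduleAlgebra k H delta eps rhoB)
    {n : M} (hn : n ∈ weakCoinv k H delta S M rhoM) {c : B}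
    (hc : c ∈ weakCoinv k H delta S B rhoB) :
    phiM (n ⊗ₜ c) ∈ weakCoinv k H delta S M rhoM := by
  have hc' : rhoB c = (PiL k H delta S).lTensor B (rhoB c) := hc
  change rhoM _ = (PiL k H delta S).lTensor M (rhoM _)
  rw [hM.rhoM_act_of_mem_weakCoinv hH hB hn]
  conv_lhs => rw [hc']
  rw [← LinearMap.comp_apply, LinearMap.rTensor_comp_lTensor, ← LinearMap.lTensor_comp_rTensor,
    LinearMap.comp_apply]

theorem qMW_mem_weakCoinv (hM : IsDoiHopfModule k H delta eps B rhoB M phiM rhoM)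
    (hH : IsWeakHopfAlgebra k H delta eps S) (h_one : h 1 = 1)
    (h_mul : ∀ x y, h (x * y) = h x * h y)
    (h_comod : rhoB ∘ₗ h = h.rTensor H ∘ₗ delta) (m : M) :
    qMW k H S B h M phiM rhoM m ∈ weakCoinv k H delta S M rhoM := by
  let a : B →ₗ[k] B ⊗[k] H := (TensorProduct.mk k B H).flip 1
  let b : H →ₗ[k] B ⊗[k] H := TensorProduct.mk k B H 1
  let ι : M →ₗ[k] M ⊗[k] H := (TensorProduct.mk k M H).flip 1
  let P := PiL k H delta S
  let ψ : (M ⊗[k] H) ⊗[k] B →ₗ[k] M ⊗[k] H := diagAct phiM ∘ₗ a.lTensor (M ⊗[k] H)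
  have hb : ∀ x y, b (x * y) = b x * b y := by simp [b]
  have h_mul' : ∀ s t : H ⊗[k] H, h.rTensor H (s * t) = h.rTensor H s * h.rTensor H t := by
    intro s t
    induction s with
    | zero => simp
    | add u v hu hv => simp only [map_add, add_mul, hu, hv]
    | tmul u v =>
      induction t with
      | zero => simp
      | add c d hc hd => simp only [map_add, mul_add, hc, hd]
      | tmul c d => simp [h_mul]
  have h1 : rhoB ∘ₗ (h ∘ₗ S) = conv delta (b ∘ₗ S) (a ∘ₗ (h ∘ₗ S)) := by
    rw [← LinearMap.comp_assoc, h_comod, LinearMap.comp_assoc, hH.delta_comp_S,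
      comp_conv h_mul']
    congr 1
    ext x
    simp [b, h_one]
  have h2 : rhoM = convAct rhoM (diagAct phiM) ι b := by
    ext m
    change rhoM m = diagAct phiM (TensorProduct.map ι b (rhoM m))
    induction rhoM m with
    | zero => simp
    | add u v hu hv => simpa only [map_add] using congrArg₂ _ hu hv
    | tmul u v => simp [ι, b, hM.act_one]
  have h3 : convAct rhoM (diagAct phiM) ι (b ∘ₗ P) = P.lTensor M ∘ₗ rhoM := by
    ext m
    change diagAct phiM (TensorProduct.map ι (b ∘ₗ P) (rhoM m)) = P.lTensor M (rhoM m)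
    induction rhoM m with
    | zero => simp
    | add u v hu hv => simp only [map_add, hu, hv]
    | tmul u v => simp [ι, b, hM.act_one]
  have assoc := convAct_convAct (A := B ⊗[k] H) hM.coassoc hM.diagAct_diagAct
  have h4 : rhoM ∘ₗ qMW k H S B h M phiM rhoM
      = convAct rhoM ψ (P.lTensor M ∘ₗ rhoM) (h ∘ₗ S) := by
    have e1 : rhoM ∘ₗ qMW k H S B h M phiM rhoM
        = convAct rhoM (diagAct phiM) rhoM (rhoB ∘ₗ (h ∘ₗ S)) :=
      comp_convAct (rho := rhoM) (phi := phiM) (phi' := diagAct phiM) (T := rhoM) (U := rhoM)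
        (τ := rhoB) hM.compat LinearMap.id (h ∘ₗ S)
    have e2 : convAct rhoM (diagAct phiM) rhoM (b ∘ₗ S) = P.lTensor M ∘ₗ rhoM := by
      refine (congrArg (convAct rhoM (diagAct phiM) · (b ∘ₗ S)) h2).trans ?_
      rw [assoc, ← h3]
      congr 1
      change _ = b ∘ₗ PiL k H delta S
      rw [PiL_eq_conv, comp_conv hb, LinearMap.comp_id]
    rw [e1, h1, ← assoc, e2]
    ext m
    exact congrArg (diagAct phiM)
      (LinearMap.congr_fun (LinearMap.lTensor_comp_map _ _ _ _).symm (rhoM m))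
  have h5 : P.lTensor M ∘ₗ (rhoM ∘ₗ qMW k H S B h M phiM rhoM)
      = rhoM ∘ₗ qMW k H S B h M phiM rhoM := by
    rw [h4, comp_convAct (phi' := ψ) (U := P.lTensor M) (τ := LinearMap.id) ?_,
      ← LinearMap.comp_assoc, ← LinearMap.lTensor_comp, LinearMap.id_comp]
    · congr 3
      ext x
      exact hH.PiL_PiL x
    · intro s c
      induction s with
      | zero => simp
      | add u v hu hv => simp only [map_add, add_tmul, hu, hv]
      | tmul u v => simp [ψ, a]
  exact (LinearMap.congr_fun h5 m).symm

/-- `q(m₍₀₎)·h(m₍₁₎) = m`. -/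
theorem act_qMW (hM : IsDoiHopfModule k H delta eps B rhoB M phiM rhoM)
    (hH : IsWeakHopfAlgebra k H delta eps S) (h_one : h 1 = 1)
    (h_mul : ∀ x y, h (x * y) = h x * h y)
    (h_comod : rhoB ∘ₗ h = h.rTensor H ∘ₗ delta) (m : M) :
    phiM (TensorProduct.map (qMW k H S B h M phiM rhoM) h (rhoM m)) = m := by
  have h1 : convAct rhoM phiM (qMW k H S B h M phiM rhoM) h
      = convAct rhoM phiM LinearMap.id (h ∘ₗ PiR k H delta S) := by
    refine (convAct_convAct hM.coassoc hM.act_assoc LinearMap.id (h ∘ₗ S) h).trans ?_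
    rw [PiR_eq_conv, comp_conv h_mul, LinearMap.comp_id]
  have h2 : ∀ s : M ⊗[k] H, phiM (TensorProduct.map LinearMap.id (h ∘ₗ PiR k H delta S) s)
      = TensorProduct.rid k M (eps.lTensor M (diagAct phiM (s ⊗ₜ h.rTensor H (delta 1)))) := by
    intro s
    induction s with
    | zero => simp
    | add u v hu hv => simp only [map_add, add_tmul, hu, hv]
    | tmul u x =>
      rw [TensorProduct.map_tmul, LinearMap.comp_apply, hH.PiR_apply]
      induction delta 1 with
      | zero => simp
      | add c d hc hd => simp only [map_add, tmul_add, hc, hd]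
      | tmul c d => simp
  have h3 : h.rTensor H (delta 1) = rhoB 1 := by
    rw [← h_one]
    exact (LinearMap.congr_fun h_comod 1).symm
  refine (LinearMap.congr_fun h1 m).trans ((h2 (rhoM m)).trans ?_)
  rw [h3, ← hM.compat, hM.act_one, hM.counit]

/-- `q_M(n·b) = n·q_B(b)` for `n` coinvariant. -/
theorem qMW_act_of_mem_weakCoinv (hM : IsDoiHopfModule k H delta eps B rhoB M phiM rhoM)
    (hH : IsWeakHopfAlgebra k H delta eps S) (hB : IsComoduleAlgebra k H delta eps rhoB)
    {n : M} (hn : n ∈ weakCoinv k H delta S M rhoM) (b : B) :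
    qMW k H S B h M phiM rhoM (phiM (n ⊗ₜ b))
      = phiM (n ⊗ₜ qMW k H S B h B (LinearMap.mul' k B) rhoB b) := by
  simp only [qMW, LinearMap.comp_apply, hM.rhoM_act_of_mem_weakCoinv hH hB hn]
  induction rhoB b with
  | zero => simp
  | add u v hu hv => simp only [map_add, tmul_add, hu, hv]
  | tmul u v => simp [hM.act_assoc]

end IsDoiHopfModule

end DoiHopfModule

/-- Fundamental theorem of weak Doi-Hopf modules (Zhang–Zhu / Böhm): for a weak Hopf
algebra `H`, a right `H`-comodule algebra `B`, a total integral `h` which is an algebra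
and comodule map, and an `(H,B)`-Doi-Hopf module `M`, the map
`ω : M^{coH} ⊗_{B^{coH}} B → M`, `n ⊗ b ↦ n·b`, is an isomorphism of Doi-Hopf modules
with inverse induced by `m ↦ q_M(m₍₀₎) ⊗ h(m₍₁₎)`.  Here the tensor product over
`B^{coH}` is presented as the quotient of `M^{coH} ⊗ B` by the span `rel` of the
elements `(n·c) ⊗ b - n ⊗ (c·b)` (`c ∈ B^{coH}`), so the claim reads: `ω` is
surjective with kernel `rel`, is `B`-linear and `H`-colinear, and
`m ↦ q_M(m₍₀₎) ⊗ h(m₍₁₎)` is a two-sided inverse modulo `rel`. -/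
theorem weak_doi_hopf_fundamental
    (hH : IsWeakHopfAlgebra k H delta eps S)
    (hB : IsComoduleAlgebra k H delta eps rhoB)
    (h_one : h 1 = 1)
    (h_mul : ∀ x y, h (x * y) = h x * h y)
    (h_comod : rhoB ∘ₗ h = h.rTensor H ∘ₗ delta)
    (m_counit : ∀ m, (TensorProduct.rid k M) ((eps.lTensor M) (rhoM m)) = m)
    (m_coassoc : rhoM.rTensor H ∘ₗ rhoM
      = (TensorProduct.assoc k M H H).symm.toLinearMap ∘ₗ delta.lTensor M ∘ₗ rhoM)
    (act_one : ∀ m, phiM (m ⊗ₜ[k] (1 : B)) = m)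
    (act_assoc : ∀ (m : M) (a b : B),
      phiM (phiM (m ⊗ₜ[k] a) ⊗ₜ[k] b) = phiM (m ⊗ₜ[k] (a * b)))
    (compat : rhoM ∘ₗ phiM = (TensorProduct.map phiM (LinearMap.mul' k H))
      ∘ₗ (TensorProduct.tensorTensorTensorComm k M H B H).toLinearMap
      ∘ₗ (TensorProduct.map rhoM rhoB)) :
    ∃ (hcl : ∀ (n : weakCoinv k H delta S M rhoM) (c : B),
        c ∈ LinearMap.eqLocus rhoB ((PiL k H delta S).lTensor B ∘ₗ rhoB) →
        phiM ((n : M) ⊗ₜ[k] c) ∈ weakCoinv k H delta S M rhoM)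
      (hp : ∀ m : M, qMW k H S B h M phiM rhoM m ∈ weakCoinv k H delta S M rhoM),
      Function.Surjective (omegaW k H delta S B M phiM rhoM) ∧
      LinearMap.ker (omegaW k H delta S B M phiM rhoM)
        = Submodule.span k {t : (weakCoinv k H delta S M rhoM) ⊗[k] B |
            ∃ (n : weakCoinv k H delta S M rhoM) (c b : B)
              (hc : c ∈ LinearMap.eqLocus rhoB ((PiL k H delta S).lTensor B ∘ₗ rhoB)),
              t = (⟨phiM ((n : M) ⊗ₜ[k] c), hcl n c hc⟩ :
                    weakCoinv k H delta S M rhoM) ⊗ₜ[k] b - n ⊗ₜ[k] (c * b)} ∧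
      (rhoM ∘ₗ omegaW k H delta S B M phiM rhoM
        = (omegaW k H delta S B M phiM rhoM).rTensor H
          ∘ₗ (TensorProduct.assoc k (weakCoinv k H delta S M rhoM) B H).symm.toLinearMap
          ∘ₗ rhoB.lTensor (weakCoinv k H delta S M rhoM)) ∧
      (∀ (t : (weakCoinv k H delta S M rhoM) ⊗[k] B) (b : B),
        phiM (omegaW k H delta S B M phiM rhoM t ⊗ₜ[k] b)
          = omegaW k H delta S B M phiM rhoM
              (((LinearMap.mulRight k b).lTensor (weakCoinv k H delta S M rhoM)) t)) ∧
      (∀ m : M, omegaW k H delta S B M phiM rhoM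
          ((TensorProduct.map
              ((qMW k H S B h M phiM rhoM).codRestrict (weakCoinv k H delta S M rhoM) hp) h)
            (rhoM m)) = m) ∧
      (∀ t : (weakCoinv k H delta S M rhoM) ⊗[k] B,
        (TensorProduct.map
            ((qMW k H S B h M phiM rhoM).codRestrict (weakCoinv k H delta S M rhoM) hp) h)
          (rhoM (omegaW k H delta S B M phiM rhoM t)) - t
          ∈ Submodule.span k {t : (weakCoinv k H delta S M rhoM) ⊗[k] B |
            ∃ (n : weakCoinv k H delta S M rhoM) (c b : B)
              (hc : c ∈ LinearMap.eqLocus rhoB ((PiL k H delta S).lTensor B ∘ₗ rhoB)),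
              t = (⟨phiM ((n : M) ⊗ₜ[k] c), hcl n c hc⟩ :
                    weakCoinv k H delta S M rhoM) ⊗ₜ[k] b - n ⊗ₜ[k] (c * b)}) := by
  have hM : IsDoiHopfModule k H delta eps B rhoB M phiM rhoM :=
    ⟨m_counit, m_coassoc, act_one, act_assoc, fun m b => LinearMap.congr_fun compat (m ⊗ₜ b)⟩
  have hBB := hB.isDoiHopfModule
  have hcl : ∀ (n : weakCoinv k H delta S M rhoM) (c : B),
      c ∈ LinearMap.eqLocus rhoB ((PiL k H delta S).lTensor B ∘ₗ rhoB) →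
      phiM ((n : M) ⊗ₜ[k] c) ∈ weakCoinv k H delta S M rhoM :=
    fun n c hc => hM.act_mem_weakCoinv hH hB n.2 hc
  have hp := hM.qMW_mem_weakCoinv hH h_one h_mul h_comod
  have hpB := hBB.qMW_mem_weakCoinv hH h_one h_mul h_comod
  have hω : ∀ (n : weakCoinv k H delta S M rhoM) (b : B),
      omegaW k H delta S B M phiM rhoM (n ⊗ₜ b) = phiM ((n : M) ⊗ₜ b) := fun n b => by
    simp [omegaW]
  have inv_right : ∀ m : M, omegaW k H delta S B M phiM rhoM
      ((TensorProduct.map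
          ((qMW k H S B h M phiM rhoM).codRestrict (weakCoinv k H delta S M rhoM) hp) h)
        (rhoM m)) = m := by
    intro m
    refine Eq.trans ?_ (hM.act_qMW hH h_one h_mul h_comod m)
    induction rhoM m with
    | zero => simp
    | add u v hu hv => simp only [map_add, hu, hv]
    | tmul u v => simp [hω]
  refine ⟨hcl, hp, fun m => ⟨_, inv_right m⟩, ?_⟩
  generalize hrel : Submodule.span k {t : (weakCoinv k H delta S M rhoM) ⊗[k] B |
    ∃ (n : weakCoinv k H delta S M rhoM) (c b : B)
      (hc : c ∈ LinearMap.eqLocus rhoB ((PiL k H delta S).lTensor B ∘ₗ rhoB)),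
      t = (⟨phiM ((n : M) ⊗ₜ[k] c), hcl n c hc⟩ :
            weakCoinv k H delta S M rhoM) ⊗ₜ[k] b - n ⊗ₜ[k] (c * b)} = rel
  have inv_left : ∀ t : (weakCoinv k H delta S M rhoM) ⊗[k] B,
      (TensorProduct.map
          ((qMW k H S B h M phiM rhoM).codRestrict (weakCoinv k H delta S M rhoM) hp) h)
        (rhoM (omegaW k H delta S B M phiM rhoM t)) - t ∈ rel := by
    intro t
    induction t with
    | zero => simp
    | add u v hu hv => simpa only [map_add, add_sub_add_comm] using rel.add_mem hu hv
    | tmul n b =>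
      have key : ∀ u : B ⊗[k] H, TensorProduct.map
          ((qMW k H S B h M phiM rhoM).codRestrict (weakCoinv k H delta S M rhoM) hp) h
            ((phiM ∘ₗ TensorProduct.mk k M B n).rTensor H u)
          - n ⊗ₜ LinearMap.mul' k B
              (TensorProduct.map (qMW k H S B h B (LinearMap.mul' k B) rhoB) h u) ∈ rel := by
        intro u
        induction u with
        | zero => simp
        | add u v hu hv =>
          simpa only [map_add, tmul_add, add_sub_add_comm] using rel.add_mem hu hv
        | tmul c x =>
          rw [← hrel]
          refine Submodule.subset_span ⟨n, _, h x, hpB c, ?_⟩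
          simp only [LinearMap.rTensor_tmul, TensorProduct.map_tmul, LinearMap.mul'_apply]
          congr 2
          exact Subtype.ext (hM.qMW_act_of_mem_weakCoinv hH hB n.2 c)
      have := key (rhoB b)
      rwa [hBB.act_qMW hH h_one h_mul h_comod, ← hM.rhoM_act_of_mem_weakCoinv hH hB n.2,
        ← hω] at this
  refine ⟨le_antisymm ?_ ?_, ?_, ?_, inv_right, inv_left⟩
  · intro t ht
    have := inv_left t
    rw [LinearMap.mem_ker.1 ht] at this
    simpa using this
  · rw [← hrel, Submodule.span_le]
    rintro _ ⟨n, c, b, hc, rfl⟩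
    simp [hω, act_assoc]
  · ext n b
    simp only [AlgebraTensorModule.curry_apply, curry_apply, LinearMap.coe_restrictScalars,
      LinearMap.comp_apply, hω, hM.rhoM_act_of_mem_weakCoinv hH hB n.2, LinearMap.lTensor_tmul,
      LinearEquiv.coe_coe]
    induction rhoB b with
    | zero => simp
    | add u v hu hv => simp only [map_add, tmul_add, hu, hv]
    | tmul u v => simp [hω]
  · intro t b
    induction t with
    | zero => simp
    | add u v hu hv => simp only [map_add, add_tmul, hu, hv]
    | tmul n c => simp [hω, act_assoc]
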